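/- arXiv:1012.5015 — 6 statements merged into one kernel-verified Lean document; each statement's English description precedes it below -/
import Mathlib

section
/- For all natural numbers m, n, k with 2 ≤ m and 1 ≤ k, one has, as an identity of rational numbers, n·( C(m−1+k, m−1) − 1 ) − k·C(m−1+k, m−2) = k · ∑_{i=1}^{m−1} ( n/i − 1 )·C(k+i−1, i−1). -/
theorem rank_increment_expansion (m n k : ℕ) (hm : 2 ≤ m) (hk : 1 ≤ k) :
    (n : ℚ) * ((Nat.choose (m - 1 + k) (m - 1) : ℚ) - 1)
        - (k : ℚ) * Nat.choose (m - 1 + k) (m - 2) =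
      (k : ℚ) * ∑ i ∈ Finset.Icc 1 (m - 1),
        ((n : ℚ) / (i : ℚ) - 1) * Nat.choose (k + i - 1) (i - 1) := by
  obtain ⟨p, rfl⟩ := Nat.exists_eq_add_of_le' hm
  clear hm
  have e1 : p + 2 - 1 = p + 1 := rfl
  have e2 : p + 2 - 2 = p := rfl
  rw [e1, e2]
  clear e1 e2
  induction p with
  | zero =>
    simp
    ring
  | succ p ih =>
    rw [Finset.sum_Icc_succ_top (by omega), mul_add, ← ih]
    have a1 : p + 1 + 1 + k = (p + 1 + k) + 1 := by omega
    have a2 : k + (p + 1 + 1) - 1 = p + 1 + k := by omega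
    have a3 : p + 1 + 1 - 1 = p + 1 := rfl
    rw [a1, a2, a3, Nat.choose_succ_succ (p + 1 + k) (p + 1), Nat.choose_succ_succ (p + 1 + k) p]
    have key := Nat.choose_succ_right_eq (p + 1 + k) (p + 1)
    rw [Nat.add_sub_cancel_left] at key
    have key2 : ((p + 1 + k).choose (p + 1 + 1) : ℚ) * ((p : ℚ) + 1 + 1)
        = (p + 1 + k).choose (p + 1) * k := by exact_mod_cast key
    have hp : (p : ℚ) + 1 + 1 ≠ 0 := by positivity
    have key3 := eq_div_of_mul_eq hp key2
    simp only [Nat.succ_eq_add_one]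
    push_cast
    rw [key3]
    field_simp
    ring
end

section
/- Let K be a field and let m, k be natural numbers with 1 ≤ m and 1 ≤ k. Consider the K-linear map φ : (H_{k−1})^m → H_k defined by φ(f_1, …, f_m) = ∑_{i=1}^{m} X_i · f_i, where H_d denotes the K-submodule of homogeneous polynomials of degree d in K[X_1, …, X_m]. Then the kernel of φ has finite dimension over K equal to m·C(m+k−2, m−1) − C(m+k−1, m−1). -/
open MvPolynomial

/-- The `K`-linear map `(f₁, …, f_m) ↦ ∑ i, X i * f i` on tuples of polynomials. -/
noncomputable def mulByVarsMap (K : Type*) [Field K] (m : ℕ) :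
    (Fin m → MvPolynomial (Fin m) K) →ₗ[K] MvPolynomial (Fin m) K :=
  ∑ i : Fin m, (LinearMap.mulLeft K (X i)).comp (LinearMap.proj i)

/-- The kernel of the multiplication map `φ : (H_{k-1})^m → H_k`, realized as the
submodule of tuples of homogeneous polynomials of degree `k - 1` mapping to `0`. -/
noncomputable def mulByVarsKernel (K : Type*) [Field K] (m k : ℕ) :
    Submodule K (Fin m → MvPolynomial (Fin m) K) :=
  (⨅ i : Fin m, Submodule.comap
      (LinearMap.proj i : (Fin m → MvPolynomial (Fin m) K) →ₗ[K] MvPolynomial (Fin m) K)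
      (homogeneousSubmodule (Fin m) K (k - 1)))
    ⊓ LinearMap.ker (mulByVarsMap K m)

theorem hmk_finrank_hom (K : Type*) [Field K] (m d : ℕ) (hm : 1 ≤ m) :
    Module.finrank K (homogeneousSubmodule (Fin m) K d) = Nat.choose (m + d - 1) (m - 1) := by
  have h : homogeneousSubmodule (Fin m) K d =
      restrictSupport K ((Finset.finsuppAntidiag (Finset.univ : Finset (Fin m)) d :
        Finset (Fin m →₀ ℕ)) : Set (Fin m →₀ ℕ)) := by
    rw [homogeneousSubmodule_eq_finsupp_supported, restrictSupport]
    congr 1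
    ext x
    simp [Finset.mem_finsuppAntidiag, Finsupp.degree_eq_sum]
  rw [h, Module.finrank_eq_card_basis (basisRestrictSupport K _)]
  simp only [Finset.coe_sort_coe, Fintype.card_coe]
  rw [Finset.card_finsuppAntidiag_nat_eq_choose]
  simp only [Finset.card_univ, Fintype.card_fin]
  rw [← Nat.choose_symm (by omega)]
  congr 1
  omega

noncomputable def hmkIncl (K : Type*) [Field K] (m d : ℕ) :
    (Fin m → homogeneousSubmodule (Fin m) K d) →ₗ[K] (Fin m → MvPolynomial (Fin m) K) :=
  (homogeneousSubmodule (Fin m) K d).subtype.compLeft (Fin m)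

theorem hmkIncl_apply (K : Type*) [Field K] (m d : ℕ)
    (f : Fin m → homogeneousSubmodule (Fin m) K d) (i : Fin m) :
    hmkIncl K m d f i = (f i : MvPolynomial (Fin m) K) := rfl

theorem hmkIncl_inj (K : Type*) [Field K] (m d : ℕ) :
    Function.Injective (hmkIncl K m d) := by
  intro f g h
  funext i
  exact Subtype.ext (congrFun h i)

theorem hmk_map_apply (K : Type*) [Field K] (m : ℕ) (f : Fin m → MvPolynomial (Fin m) K) :
    mulByVarsMap K m f = ∑ i, X i * f i := by
  simp [mulByVarsMap]

theorem hmk_kernel_eq (K : Type*) [Field K] (m k : ℕ) :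
    mulByVarsKernel K m k =
      (LinearMap.ker (mulByVarsMap K m ∘ₗ hmkIncl K m (k - 1))).map (hmkIncl K m (k - 1)) := by
  ext f
  simp only [mulByVarsKernel, Submodule.mem_inf, Submodule.mem_iInf, Submodule.mem_comap,
    LinearMap.proj_apply, Submodule.mem_map, LinearMap.mem_ker, LinearMap.comp_apply]
  constructor
  · rintro ⟨h1, h2⟩
    exact ⟨fun i => ⟨f i, h1 i⟩, h2, rfl⟩
  · rintro ⟨g, h, rfl⟩
    exact ⟨fun i => (g i).2, h⟩

theorem hmk_range_eq (K : Type*) [Field K] (m d : ℕ) :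
    LinearMap.range (mulByVarsMap K m ∘ₗ hmkIncl K m d) =
      homogeneousSubmodule (Fin m) K (d + 1) := by
  apply le_antisymm
  · rintro _ ⟨f, rfl⟩
    rw [LinearMap.comp_apply, hmk_map_apply]
    refine Submodule.sum_mem _ fun i _ => ?_
    rw [mem_homogeneousSubmodule, add_comm]
    exact (isHomogeneous_X K i).mul (f i).2
  · rw [← homogeneousSubmodule_one_pow, pow_succ', homogeneousSubmodule_one_pow,
      homogeneousSubmodule_one_eq_span_X, Submodule.mul_le]
    intro a ha b hb
    induction ha using Submodule.span_induction with
    | mem x hx =>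
      obtain ⟨i, rfl⟩ := hx
      refine ⟨Pi.single i ⟨b, hb⟩, ?_⟩
      rw [LinearMap.comp_apply, hmk_map_apply, Finset.sum_eq_single i]
      · simp [hmkIncl_apply]
      · intro j _ hj
        simp [hmkIncl_apply, Pi.single_eq_of_ne hj]
      · simp
    | zero => simp
    | add x y _ _ hx hy => rw [add_mul]; exact Submodule.add_mem _ hx hy
    | smul c x _ hx => rw [smul_mul_assoc]; exact Submodule.smul_mem _ c hx

theorem homogeneous_multiplication_kernel_finrank
    (K : Type*) [Field K] (m k : ℕ) (hm : 1 ≤ m) (hk : 1 ≤ k) :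
    Module.finrank K (mulByVarsKernel K m k) =
      m * Nat.choose (m + k - 2) (m - 1) - Nat.choose (m + k - 1) (m - 1) := by
  obtain ⟨d, rfl⟩ : ∃ d, k = d + 1 := ⟨k - 1, by omega⟩
  have : Module.Finite K (homogeneousSubmodule (Fin m) K d) :=
    Module.Finite.iff_fg.mpr (homogeneousSubmodule_fg _ _ d)
  rw [hmk_kernel_eq, ← (Submodule.equivMapOfInjective _ (hmkIncl_inj K m _) _).finrank_eq]
  change Module.finrank K (LinearMap.ker (mulByVarsMap K m ∘ₗ hmkIncl K m d)) = _
  have h := LinearMap.finrank_range_add_finrank_ker (mulByVarsMap K m ∘ₗ hmkIncl K m d)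
  rw [hmk_range_eq, hmk_finrank_hom K m _ hm, Module.finrank_pi_fintype] at h
  simp only [hmk_finrank_hom K m _ hm, Finset.sum_const, Finset.card_univ, Fintype.card_fin,
    smul_eq_mul] at h
  have e : m + (d + 1) - 2 = m + d - 1 := by omega
  rw [e, ← h]
  omega
end

section
/- There are no integers x, y such that 19·y = 46·x² − 297·x + 534 and y ≤ x² − 8. -/
theorem no_integral_points_P10 :
    ¬ ∃ x y : ℤ, 19 * y = 46 * x ^ 2 - 297 * x + 534 ∧ y ≤ x ^ 2 - 8 := by
  rintro ⟨x, y, h1, h2⟩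
  have hx1 : 4 ≤ x := by nlinarith
  have hx2 : x ≤ 7 := by nlinarith
  interval_cases x <;> omega
end

section
/- Let e, a, b, d be integers with e ≥ 1, a ≥ 2, b ≥ e·a + 2 and d ≥ 10. If 12·e·a² − 24·a·b + 34·(2 − e)·a + 68·b = 9·d + 104, then a = 2 and 20·(b − e) = 9·d − 32. -/
theorem hirzebruch_diophantine (e a b d : ℤ) (he : 1 ≤ e) (ha : 2 ≤ a)
    (hb : e * a + 2 ≤ b) (hd : 10 ≤ d)
    (h : 12 * e * a ^ 2 - 24 * a * b + 34 * (2 - e) * a + 68 * b = 9 * d + 104) :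
    a = 2 ∧ 20 * (b - e) = 9 * d - 32 := by
  have h2 : a = 2 := by
    by_contra hne
    have h3 : 3 ≤ a := by omega
    have p1 : 0 ≤ (24 * a - 68) * (b - (e * a + 2)) :=
      mul_nonneg (by linarith) (by linarith)
    have p2 : 0 ≤ (e - 1) * (a * (12 * a - 34)) :=
      mul_nonneg (by linarith) (mul_nonneg (by linarith) (by linarith))
    have p3 : 0 ≤ (a - 3) * (12 * a - 18) :=
      mul_nonneg (by linarith) (by linarith)
    linarith
  subst h2
  exact ⟨rfl, by linarith⟩
end

section
/- Let q, a, b, d be integers with q ≥ 1, a ≥ 2, b ≥ 5 and d ≥ 1. If 24·a·b + 68·(q − 1)·a − 68·b + 9·d = 104·(q − 1), then a = 2 and 20·b = 9·d + 32·(q − 1). -/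
theorem product_surface_diophantine (q a b d : ℤ) (hq : 1 ≤ q) (ha : 2 ≤ a)
    (hb : 5 ≤ b) (hd : 1 ≤ d)
    (h : 24 * a * b + 68 * (q - 1) * a - 68 * b + 9 * d = 104 * (q - 1)) :
    a = 2 ∧ 20 * b = 9 * d + 32 * (q - 1) := by
  have h2 : a = 2 := by
    by_contra hne
    have h3 : 3 ≤ a := by omega
    have e1 : 0 ≤ (a - 3) * b := mul_nonneg (by linarith) (by linarith)
    have e2 : 0 ≤ (q - 1) * (a - 3) := mul_nonneg (by linarith) (by linarith)
    nlinarith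
  subst h2
  exact ⟨rfl, by linarith⟩
end

section
/- The only integers x, y, d with x ≥ 2, y ≥ 1, d ≥ 1 satisfying d = x³ − 2·x·y and 7·d + 32·y = −4·x³ + 52·x² − 62·x are (x, y, d) = (4, 5, 24). -/
theorem unique_solution_P3_ell2 (x y d : ℤ) (hx : 2 ≤ x) (hy : 1 ≤ y) (hd : 1 ≤ d) :
    (d = x ^ 3 - 2 * x * y ∧ 7 * d + 32 * y = -4 * x ^ 3 + 52 * x ^ 2 - 62 * x) ↔
      (x = 4 ∧ y = 5 ∧ d = 24) := by
  constructor
  · rintro ⟨h1, h2⟩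
    have hx2 : x ≤ 12 := by
      by_contra! h
      nlinarith [mul_nonneg (sq_nonneg x) (by linarith : (0:ℤ) ≤ x - 13)]
    interval_cases x <;> omega
  · rintro ⟨rfl, rfl, rfl⟩
    norm_num
end
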